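/- arXiv:1610.00477 — 3 statements merged into one kernel-verified Lean document; each statement's English description precedes it below -/
import Mathlib

section
/- Let B be a finite left brace and p a prime. Then the Sylow p-subgroup of the additive group (B,+), namely S = { b ∈ B : the additive order of b is a power of p }, is a left ideal of B; that is, S is a subgroup of the multiplicative group (B,·) and λ_b(a) ∈ S for all a ∈ S and b ∈ B. -/
/-- A left brace: a set with an abelian group structure `(B,+)` and a group structure
`(B,·)` satisfying `a·(b+c)+a = a·b+a·c`. -/
class LeftBrace (B : Type*) extends AddCommGroup B, Group B where
  left_compat : ∀ a b c : B, a * (b + c) + a = a * b + a * c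

namespace LeftBrace

variable {B : Type*} [LeftBrace B]

theorem mul_zero_eq (a : B) : a * (0 : B) = a := by
  have h := left_compat a 0 0
  rw [add_zero] at h
  exact (add_left_cancel h).symm

theorem one_eq_zero : (1 : B) = 0 := by
  simpa using (mul_zero_eq (1 : B)).symm

/-- The additive endomorphism `b ↦ a·b − a`. -/
def lambda (a : B) : B →+ B where
  toFun b := a * b - a
  map_zero' := by rw [mul_zero_eq, sub_self]
  map_add' b c := by
    rw [eq_sub_of_add_eq (left_compat a b c)]
    abel

theorem lambda_apply (a b : B) : lambda a b = a * b - a := rfl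

theorem lambda_injective (a : B) : Function.Injective (lambda a) := fun _ _ h =>
  mul_left_cancel (sub_left_injective h)

theorem addOrderOf_lambda (a b : B) : addOrderOf (lambda a b) = addOrderOf b :=
  addOrderOf_injective (lambda a) (lambda_injective a) b

theorem mul_eq_add_lambda (a b : B) : a * b = a + lambda a b := by
  rw [lambda_apply, add_sub_cancel]

theorem addOrderOf_inv (a : B) : addOrderOf a⁻¹ = addOrderOf a := by
  rw [← addOrderOf_lambda a, lambda_apply, mul_inv_cancel, one_eq_zero, zero_sub, addOrderOf_neg]

end LeftBrace

/-- Let `B` be a finite left brace and `p` a prime. The Sylow `p`-subgroup of `(B,+)`,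
`S = { b ∈ B : the additive order of b is a power of p }`, is a left ideal of `B`:
it is a subgroup of the multiplicative group `(B,·)` (it contains `1`, and is closed
under multiplication and inverses) and `λ_b(a) = b·a − b ∈ S` for all `a ∈ S`, `b ∈ B`. -/
theorem sylow_addSubgroup_is_leftIdeal {B : Type*} [LeftBrace B] [Fintype B]
    (p : ℕ) (hp : p.Prime) :
    (1 : B) ∈ {b : B | ∃ k : ℕ, addOrderOf b = p ^ k} ∧
    (∀ a ∈ {b : B | ∃ k : ℕ, addOrderOf b = p ^ k},
      ∀ b ∈ {b : B | ∃ k : ℕ, addOrderOf b = p ^ k},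
        a * b ∈ {b : B | ∃ k : ℕ, addOrderOf b = p ^ k}) ∧
    (∀ a ∈ {b : B | ∃ k : ℕ, addOrderOf b = p ^ k},
        a⁻¹ ∈ {b : B | ∃ k : ℕ, addOrderOf b = p ^ k}) ∧
    (∀ a ∈ {b : B | ∃ k : ℕ, addOrderOf b = p ^ k},
      ∀ b : B, b * a - b ∈ {b : B | ∃ k : ℕ, addOrderOf b = p ^ k}) := by
  have : Fact p.Prime := ⟨hp⟩
  refine ⟨⟨0, ?_⟩, fun a ha b hb => ?_, fun a ha => ?_, fun a ha b => ?_⟩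
  · rw [LeftBrace.one_eq_zero, addOrderOf_zero, pow_zero]
  · rw [LeftBrace.mul_eq_add_lambda]
    refine AddCommMonoid.mem_primaryComponent_iff_addOrderOf.mp (add_mem
      (AddCommMonoid.mem_primaryComponent_iff_addOrderOf.mpr ha)
      (AddCommMonoid.mem_primaryComponent_iff_addOrderOf.mpr ?_))
    obtain ⟨k, hk⟩ := hb
    exact ⟨k, (LeftBrace.addOrderOf_lambda a b).trans hk⟩
  · obtain ⟨k, hk⟩ := ha
    exact ⟨k, (LeftBrace.addOrderOf_inv a).trans hk⟩
  · obtain ⟨k, hk⟩ := ha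
    exact ⟨k, (LeftBrace.addOrderOf_lambda b a).trans hk⟩
end

section
/- Let B_1,…,B_s be left braces and, for all i ≠ j in {1,…,s}, let α^{(i,j)} : (B_i,·) → Aut(B_j,+,·) be group homomorphisms into the groups of brace automorphisms of B_j, written α^{(i,j)}(a) = α^{(i,j)}_a. Assume that (i) α^{(i,j)}_{α^{(k,i)}_{a_k}(a_i)} = α^{(i,j)}_{a_i} and (ii) α^{(j,i)}_{a_j} ∘ α^{(k,i)}_{a_k} = α^{(k,i)}_{a_k} ∘ α^{(j,i)}_{a_j}, for all i,j,k ∈ {1,…,s} with i ≠ j and i ≠ k, and all a_m ∈ B_m. Then for all pairwise distinct i,j,k and all a ∈ B_i, b ∈ B_j, c ∈ B_k the following hold: (IM1) λ^{(i)}_a ∘ α^{(j,i)}_{(α^{(i,j)}_a)^{-1}(b)} = α^{(j,i)}_b ∘ λ^{(i)}_{(α^{(j,i)}_b)^{-1}(a)}, and (IM2) α^{(k,i)}_c ∘ α^{(j,i)}_{(α^{(k,j)}_c)^{-1}(b)} = α^{(j,i)}_b ∘ α^{(k,i)}_{(α^{(j,k)}_b)^{-1}(c)}, where λ^{(i)}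 is the lambda map of B_i. -/
/-- **Proposition (matched product criterion).** Let `B_1,…,B_s` be left braces and
`α^{(i,j)} : (B_i,·) → Aut(B_j,+,·)` group homomorphisms into the groups of brace
automorphisms of `B_j` (`i ≠ j`), satisfying
(i) `α^{(i,j)}_{α^{(k,i)}_{a_k}(a_i)} = α^{(i,j)}_{a_i}` and
(ii) `α^{(j,i)}_{a_j} ∘ α^{(k,i)}_{a_k} = α^{(k,i)}_{a_k} ∘ α^{(j,i)}_{a_j}`.
Then for all pairwise distinct `i,j,k`, `a ∈ B_i`, `b ∈ B_j`, `c ∈ B_k`: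
(IM1) `λ^{(i)}_a ∘ α^{(j,i)}_{(α^{(i,j)}_a)⁻¹(b)} = α^{(j,i)}_b ∘ λ^{(i)}_{(α^{(j,i)}_b)⁻¹(a)}` and
(IM2) `α^{(k,i)}_c ∘ α^{(j,i)}_{(α^{(k,j)}_c)⁻¹(b)} = α^{(j,i)}_b ∘ α^{(k,i)}_{(α^{(j,k)}_b)⁻¹(c)}`,
where `λ^{(i)}_a(x) = a·x − a` is the lambda map of `B_i` and inverses of the bijections
`α^{(i,j)}_a` are taken as functions. -/
theorem matched_product_criterion {s : ℕ} (B : Fin s → Type*) [∀ i, LeftBrace (B i)]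
    (α : ∀ i j : Fin s, B i → B j → B j)
    (hbij : ∀ i j : Fin s, i ≠ j → ∀ a : B i, Function.Bijective (α i j a))
    (hadd : ∀ i j : Fin s, i ≠ j → ∀ a : B i, ∀ x y : B j,
      α i j a (x + y) = α i j a x + α i j a y)
    (hmulpres : ∀ i j : Fin s, i ≠ j → ∀ a : B i, ∀ x y : B j,
      α i j a (x * y) = α i j a x * α i j a y)
    (hhom : ∀ i j : Fin s, i ≠ j → ∀ a a' : B i, ∀ x : B j,
      α i j (a * a') x = α i j a (α i j a' x))
    (hyp1 : ∀ i j k : Fin s, i ≠ j → i ≠ k → ∀ (ak : B k) (ai : B i) (x : B j),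
      α i j (α k i ak ai) x = α i j ai x)
    (hyp2 : ∀ i j k : Fin s, i ≠ j → i ≠ k → ∀ (aj : B j) (ak : B k) (x : B i),
      α j i aj (α k i ak x) = α k i ak (α j i aj x)) :
    ∀ i j k : Fin s, i ≠ j → i ≠ k → j ≠ k →
      ∀ (a : B i) (b : B j) (c : B k),
        -- (IM1)
        (∀ x : B i,
          a * (α j i (Function.invFun (α i j a) b) x) - a
            = α j i b ((Function.invFun (α j i b) a) * x - Function.invFun (α j i b) a)) ∧
        -- (IM2)
        (∀ x : B i,
          α k i c (α j i (Function.invFun (α k j c) b) x)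
            = α j i b (α k i (Function.invFun (α j k b) c) x)) := by
  intro i j k hij hik hjk a b c
  have α_invFun (m n : Fin s) (h : m ≠ n) (u : B m) (v : B n) :
      α m n u (Function.invFun (α m n u) v) = v :=
    Function.invFun_eq ((hbij m n h u).2 v)
  have α_sub (x y : B i) : α j i b (x - y) = α j i b x - α j i b y :=
    map_sub (AddMonoidHom.mk' (α j i b) (hadd j i hij.symm b)) x y
  -- By the first compatibility condition, untwisting an index does not change its action.
  have α_untwist (l m n : Fin s) (hlm : l ≠ m) (hnm : n ≠ m) (u : B l) (v : B m) (x : B n) :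
      α m n (Function.invFun (α l m u) v) x = α m n v x := by
    rw [← hyp1 m n l hnm.symm hlm.symm u, α_invFun l m hlm]
  refine ⟨fun x => ?_, fun x => ?_⟩
  · rw [α_untwist i j i hij hij, α_sub, hmulpres j i hij.symm, α_invFun j i hij.symm]
  · rw [α_untwist k j i hjk.symm hij, α_untwist j k i hjk hik, hyp2 i j k hij hik]
end

section
/- Let p and q be distinct primes and let n be the multiplicative order of p modulo q. Then every finite group G of order p^n·q has a normal Sylow p-subgroup or a normal Sylow q-subgroup. -/
/-- Let `p` and `q` be distinct primes and let `n` be the multiplicative order of `p`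
modulo `q` (the least positive integer with `p^n ≡ 1 (mod q)`). Then every finite group
`G` of order `p^n·q` has a normal Sylow `p`-subgroup (a normal subgroup of order `p^n`)
or a normal Sylow `q`-subgroup (a normal subgroup of order `q`). -/
theorem normal_sylow_of_card_pow_mul_prime (p q : ℕ) (hp : p.Prime) (hq : q.Prime)
    (hpq : p ≠ q) (n : ℕ) (hn : 0 < n) (horder : p ^ n ≡ 1 [MOD q])
    (hmin : ∀ m : ℕ, 0 < m → p ^ m ≡ 1 [MOD q] → n ≤ m)
    (G : Type*) [Group G] [Fintype G] (hG : Fintype.card G = p ^ n * q) :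
    (∃ P : Subgroup G, Nat.card P = p ^ n ∧ P.Normal) ∨
    (∃ P : Subgroup G, Nat.card P = q ∧ P.Normal) := by
  have : Fact q.Prime := ⟨hq⟩
  rw [← Nat.card_eq_fintype_card] at hG
  obtain ⟨H, hH⟩ := Sylow.exists_subgroup_card_pow_prime (G := G) q (n := 1)
    (by rw [hG, pow_one]; exact dvd_mul_left q _)
  have hqp : ¬ q ∣ p ^ n := fun h ↦
    hpq ((Nat.prime_dvd_prime_iff_eq hq hp).1 (hq.dvd_of_dvd_pow h)).symm
  have hcard : Nat.card H = q ^ (Nat.card G).factorization q := by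
    rw [hH, hG, Nat.factorization_mul (pow_ne_zero _ hp.ne_zero) hq.ne_zero]
    rw [Finsupp.add_apply, Nat.factorization_eq_zero_of_not_dvd hqp, hq.factorization_self]
  rw [pow_one] at hH
  let Q : Sylow q G := Sylow.ofCard H hcard
  have hQ : Nat.card (Q : Subgroup G) = q := hH
  have hindex : (Q : Subgroup G).index = p ^ n := by
    have h := (Q : Subgroup G).index_mul_card
    rw [hQ, hG] at h
    exact Nat.eq_of_mul_eq_mul_right hq.pos h
  obtain ⟨m, hmn, hm⟩ := (Nat.dvd_prime_pow hp).1 (hindex ▸ Q.card_dvd_index)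
  have hmod : p ^ m ≡ 1 [MOD q] := hm ▸ card_sylow_modEq_one q G
  rcases Nat.eq_zero_or_pos m with rfl | hm0
  · right
    rw [pow_zero] at hm
    have := (Nat.card_eq_one_iff_unique.1 hm).1
    exact ⟨Q, hQ, Q.normal_of_subsingleton⟩
  · left
    obtain rfl : m = n := le_antisymm hmn (hmin m hm0 hmod)
    have hN : Subgroup.normalizer ((Q : Subgroup G) : Set G) = Q := by
      refine (Subgroup.eq_of_le_of_card_ge Subgroup.le_normalizer ?_).symm
      have h := (Subgroup.normalizer ((Q : Subgroup G) : Set G)).index_mul_card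
      rw [show (Subgroup.normalizer ((Q : Subgroup G) : Set G)).index = p ^ m from
        Q.card_eq_index_normalizer.symm.trans hm, hG] at h
      exact (Nat.eq_of_mul_eq_mul_left (pow_pos hp.pos _) h).trans hQ.symm |>.le
    have : IsCyclic (Q : Subgroup G) := isCyclic_of_prime_card hQ
    have hC : Subgroup.normalizer ((Q : Subgroup G) : Set G) ≤
        Subgroup.centralizer ((Q : Subgroup G) : Set G) :=
      hN.le.trans (Subgroup.le_centralizer _)
    have hK := MonoidHom.ker_transferSylow_isComplement' Q hC
    exact ⟨(MonoidHom.transferSylow Q hC).ker, hK.index_eq_card.symm.trans hindex, inferInstance⟩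
end
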